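/- arXiv:2304.11690 — 2 statements merged into one kernel-verified Lean document; each statement's English description precedes it below -/
import Mathlib

section
/- For ν = 2, let s_ab^c be the structure constants defined by φ_a · φ_b = Σ_c s_ab^c φ_c. Suppose a + b ≤ n_2, max(a, b) ≤ c ≤ a + b, and c ≤ min(n_1, n_2). Then s_ab^c = [a! b! (n_1−a)! (n_2−a)! (n_1−b)! (n_2−b)!] / [n_1! n_2! (n_1−c)! (n_2−a−b)! (a+b−c)! (c−a)! (c−b)!] · Σ_{σ=0}^{a+b−c} [(−a)_σ (−b)_σ (c−a−b)_σ (c−n_1)_σ] / [(c−b+1)_σ (c−a+1)_σ (n_2−a−b+1)_σ · σ!], where (x)_σ = x(x+1)⋯(x+σ−1) denotes the ascending Pochhammer symbol. -/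
open Finset

def countMat {Ω : Type} [Fintype Ω] [DecidableEq Ω] {ν : ℕ}
    (P : Fin ν → Finset Ω) (g : Equiv.Perm Ω) (i j : Fin ν) : ℕ :=
  ((P i).image ⇑g ∩ P j).card

def IsPartition {Ω : Type} [Fintype Ω] {ν : ℕ} (n : Fin ν → ℕ) (P : Fin ν → Finset Ω) : Prop :=
  (∀ i j, i ≠ j → Disjoint (P i) (P j)) ∧ (∀ x : Ω, ∃ j, x ∈ P j) ∧ ∀ j, (P j).card = n j

def xiFinset {Ω : Type} [Fintype Ω] [DecidableEq Ω] {ν : ℕ}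
    (P : Fin ν → Finset Ω) (a : Fin ν → Fin ν → ℕ) : Finset (Equiv.Perm Ω) :=
  Finset.univ.filter (fun g => ∀ i j, countMat P g i j = a i j)

noncomputable def muC {ν : ℕ} (n : Fin ν → ℕ) (a : Fin ν → Fin ν → ℕ) : ℚ :=
  (∏ j, ((n j).factorial : ℚ)) ^ 2 / ∏ i, ∏ j, ((a i j).factorial : ℚ)

noncomputable def XiElt {Ω : Type} [Fintype Ω] [DecidableEq Ω] {ν : ℕ}
    (n : Fin ν → ℕ) (P : Fin ν → Finset Ω) (a : Fin ν → Fin ν → ℕ) :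
    MonoidAlgebra ℚ (Equiv.Perm Ω) :=
  (muC n a)⁻¹ • ∑ g ∈ xiFinset P a, MonoidAlgebra.of ℚ (Equiv.Perm Ω) g

def phiMat (n : Fin 2 → ℕ) (a : ℕ) : Fin 2 → Fin 2 → ℕ :=
  fun i j => if i = j then n i - a else a

/-- The ascending Pochhammer symbol `(x)_σ = x (x+1) ⋯ (x+σ−1)`. -/
noncomputable def poch (x : ℚ) (s : ℕ) : ℚ := ∏ m ∈ Finset.range s, (x + m)

theorem filter_biUnion_eq {Ω ι : Type*} [Fintype Ω] [DecidableEq Ω] [Fintype ι] [DecidableEq ι]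
    {f : Ω → ι} {F : ι → Finset Ω} (hF : ∀ i, F i ⊆ univ.filter fun x => f x = i) (i : ι) :
    ((univ.biUnion F).filter fun x => f x = i) = F i := by
  ext x
  simp only [mem_filter, mem_biUnion, mem_univ, true_and]
  constructor
  · rintro ⟨⟨j, hj⟩, rfl⟩
    rwa [(mem_filter.1 (hF j hj)).2]
  · exact fun hx => ⟨⟨i, hx⟩, (mem_filter.1 (hF i hx)).2⟩

theorem card_filter_forall_card_filter_eq {Ω ι : Type*} [Fintype Ω] [DecidableEq Ω] [Fintype ι]
    [DecidableEq ι] (f : Ω → ι) (k : ι → ℕ) :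
    #{X : Finset Ω | ∀ i, #(X.filter fun x => f x = i) = k i} =
      ∏ i, (#(univ.filter fun x => f x = i)).choose (k i) := by
  simp_rw [← card_powersetCard, ← Fintype.card_piFinset]
  refine card_nbij' (fun X i => X.filter fun x => f x = i) (fun F => univ.biUnion F) ?_ ?_ ?_ ?_
  · intro X hX
    simp only [mem_coe, mem_filter, mem_univ, true_and] at hX
    simp only [mem_coe, Fintype.mem_piFinset, mem_powersetCard]
    exact fun i => ⟨filter_subset_filter _ (subset_univ _), hX i⟩
  · intro F hF
    simp only [mem_coe, Fintype.mem_piFinset, mem_powersetCard] at hF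
    simp only [mem_coe, mem_filter, mem_univ, true_and]
    intro i
    rw [filter_biUnion_eq fun j => (hF j).1]
    exact (hF i).2
  · intro X _
    ext x
    simp
  · intro F hF
    simp only [mem_coe, Fintype.mem_piFinset, mem_powersetCard] at hF
    exact funext fun i => filter_biUnion_eq (fun j => (hF j).1) i

theorem card_filter_image_perm_eq {Ω : Type*} [Fintype Ω] [DecidableEq Ω] {A X : Finset Ω}
    (h : #X = #A) :
    #{g : Equiv.Perm Ω | A.image g = X} = (#A).factorial * (#Aᶜ).factorial := by
  obtain ⟨e, he⟩ : ∃ e : Equiv.Perm Ω, A.image e = X := by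
    let e := (Finset.equivOfCardEq h.symm).extendSubtype
    refine ⟨e, eq_of_subset_of_card_le ?_ (by rw [card_image_of_injective _ e.injective, h])⟩
    intro y hy
    obtain ⟨x, hx, rfl⟩ := mem_image.1 hy
    exact (Finset.equivOfCardEq h.symm).extendSubtype_mem x hx
  have key := DomMulAct.stabilizer_card (fun x => decide (x ∈ A))
  rw [Fintype.card_subtype] at key
  simp only [Fintype.univ_bool, Fintype.card_subtype] at key
  rw [prod_pair (by simp)] at key
  have h1 : (univ.filter fun a => decide (a ∈ A) = true) = A := by ext; simp
  have h2 : (univ.filter fun a => decide (a ∈ A) = false) = Aᶜ := by ext; simp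
  rw [h1, h2] at key
  rw [← key]
  refine card_nbij' (fun g => e⁻¹ * g) (fun g => e * g) ?_ ?_ ?_ ?_
  · intro g hg
    simp only [mem_coe, mem_filter, mem_univ, true_and] at hg ⊢
    ext x
    have hx : e (e⁻¹ (g x)) = g x := e.apply_symm_apply _
    rw [Function.comp_apply, decide_eq_decide, Equiv.Perm.mul_apply,
      ← e.injective.mem_finset_image, he, ← hg, hx,
      g.injective.mem_finset_image]
  · intro g hg
    simp only [mem_coe, mem_filter, mem_univ, true_and] at hg ⊢
    have hA : A.image g = A := by
      refine eq_of_subset_of_card_le ?_ (by rw [card_image_of_injective _ g.injective])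
      intro y hy
      obtain ⟨x, hx, rfl⟩ := mem_image.1 hy
      simpa [hx] using congrFun hg x
    rw [Equiv.Perm.coe_mul, ← image_image, hA, he]
  · intro g _; simp
  · intro g _; simp

theorem card_filter_image_perm {Ω : Type*} [Fintype Ω] [DecidableEq Ω] (A : Finset Ω)
    (p : Finset Ω → Prop) [DecidablePred p] :
    #{g : Equiv.Perm Ω | p (A.image g)} =
      #{X : Finset Ω | #X = #A ∧ p X} * ((#A).factorial * (#Aᶜ).factorial) := by
  rw [card_eq_sum_card_fiberwise (f := fun g : Equiv.Perm Ω => A.image g)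
    (t := {X : Finset Ω | #X = #A ∧ p X}), sum_const_nat]
  · intro X hX
    simp only [mem_filter, mem_univ, true_and] at hX
    rw [← card_filter_image_perm_eq hX.1, filter_filter]
    congr 1
    ext g
    simp only [mem_filter, mem_univ, true_and, and_iff_right_iff_imp]
    rintro rfl
    exact hX.2
  · intro g hg
    simpa [card_image_of_injective _ g.injective] using hg

theorem poch_neg_natCast {m σ : ℕ} (h : σ ≤ m) :
    poch (-(m : ℚ)) σ = (-1) ^ σ * m.factorial / (m - σ).factorial := by
  induction σ with
  | zero => simp [poch, Nat.factorial_ne_zero]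
  | succ k ih =>
    have ih := ih (by omega)
    unfold poch at ih ⊢
    rw [prod_range_succ, ih]
    obtain ⟨d, rfl⟩ : ∃ d, m = k + 1 + d := ⟨m - (k + 1), by omega⟩
    have e1 : k + 1 + d - k = d + 1 := by omega
    have e2 : k + 1 + d - (k + 1) = d := by omega
    rw [e1, e2, Nat.factorial_succ d]
    push_cast
    field_simp
    ring

theorem poch_neg_natCast_of_lt {m σ : ℕ} (h : m < σ) : poch (-(m : ℚ)) σ = 0 :=
  prod_eq_zero (mem_range.2 h) (by simp)

theorem poch_natCast_add_one (m σ : ℕ) :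
    poch ((m : ℚ) + 1) σ = (m + σ).factorial / m.factorial := by
  induction σ with
  | zero => simp [poch, Nat.factorial_ne_zero]
  | succ k ih =>
    unfold poch at ih ⊢
    rw [prod_range_succ, ih, ← add_assoc, Nat.factorial_succ]
    push_cast
    ring

theorem coeff_XiElt {Ω : Type} [Fintype Ω] [DecidableEq Ω] {ν : ℕ}
    (n : Fin ν → ℕ) (P : Fin ν → Finset Ω) (a : Fin ν → Fin ν → ℕ) (g : Equiv.Perm Ω) :
    (XiElt n P a).coeff g = if g ∈ xiFinset P a then (muC n a)⁻¹ else 0 := by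
  simp [XiElt, MonoidAlgebra.of_apply, Finsupp.single_apply]

theorem coeff_XiElt_mul_XiElt {Ω : Type} [Fintype Ω] [DecidableEq Ω] {ν : ℕ}
    (n : Fin ν → ℕ) (P : Fin ν → Finset Ω) (a b : Fin ν → Fin ν → ℕ) (g : Equiv.Perm Ω) :
    (XiElt n P a * XiElt n P b).coeff g =
      (muC n a)⁻¹ * (muC n b)⁻¹ *
        #{h : Equiv.Perm Ω | h ∈ xiFinset P a ∧ h⁻¹ * g ∈ xiFinset P b} := by
  rw [XiElt, smul_mul_assoc, Finset.sum_mul]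
  simp only [MonoidAlgebra.coeff_smul_apply, MonoidAlgebra.coeff_sum, Finsupp.finsetSum_apply,
    MonoidAlgebra.of_apply,
    MonoidAlgebra.coeff_single_mul_apply, coeff_XiElt, one_mul, smul_eq_mul]
  rw [← sum_filter, sum_const, nsmul_eq_mul, filter_and, filter_mem_eq_inter, univ_inter,
    mul_comm _ (muC n b)⁻¹, ← mul_assoc]
  congr 3
  ext h
  simp

theorem eq_compl_of_isPartition {n : Fin 2 → ℕ} {Ω : Type} [Fintype Ω] [DecidableEq Ω]
    {P : Fin 2 → Finset Ω} (hP : IsPartition n P) : P 1 = (P 0)ᶜ := by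
  ext x
  have h1 : x ∈ P 0 → x ∉ P 1 := fun h => disjoint_left.1 (hP.1 0 1 (by simp)) h
  obtain ⟨j, hj⟩ := hP.2.1 x
  simp only [mem_compl]
  fin_cases j <;> simp at hj <;> tauto

theorem mem_xiFinset_phiMat {n : Fin 2 → ℕ} {Ω : Type} [Fintype Ω] [DecidableEq Ω]
    {P : Fin 2 → Finset Ω} (hP : IsPartition n P) {a : ℕ}
    {g : Equiv.Perm Ω} : g ∈ xiFinset P (phiMat n a) ↔ #((P 0).image g \ P 0) = a := by
  have hc := eq_compl_of_isPartition hP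
  have h0 := hP.2.2 0
  have h1 := hP.2.2 1
  have hd (j : Fin 2) : #((P j).image g ∩ P 0) + #((P j).image g ∩ P 1) = n j := by
    rw [hc, ← sdiff_eq_inter_compl, card_inter_add_card_sdiff,
      card_image_of_injective _ g.injective, hP.2.2]
  have hi : (P 1).image g = ((P 0).image g)ᶜ := by
    ext y
    obtain ⟨x, rfl⟩ := g.surjective y
    simp [hc]
  have hd' (j : Fin 2) : #((P 0).image g ∩ P j) + #((P 1).image g ∩ P j) = n j := by
    rw [← hP.2.2 j, inter_comm, inter_comm _ (P j), hi,
      ← sdiff_eq_inter_compl, card_inter_add_card_sdiff]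
  have e0 := hd 0
  have e1 := hd 1
  have e2 := hd' 0
  have e3 := hd' 1
  rw [sdiff_eq_inter_compl, ← hc]
  simp only [xiFinset, countMat, phiMat, mem_filter, mem_univ, true_and, Fin.forall_fin_two]
  simp
  omega

theorem card_filter_card_sdiff {Ω : Type*} [Fintype Ω] [DecidableEq Ω] {A B : Finset Ω}
    {a b c : ℕ} (hAB : #B = #A) (hB : #(B \ A) = c) (hac : a ≤ c) (hbc : b ≤ c)
    (hc : c ≤ a + b) :
    #{X : Finset Ω | #X = #A ∧ #(X \ A) = a ∧ #(B \ X) = b} =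
      ∑ σ ∈ range (a + b - c + 1), (#A - c).choose σ * c.choose (c - a + σ) *
        c.choose (c - b + σ) * (#Aᶜ - c).choose (a + b - c - σ) := by
  let f : Ω → Bool × Bool := fun x => (decide (x ∈ A), decide (x ∈ B))
  have hf (X : Finset Ω) : (#(X.filter fun x => f x = (true, true)) = #(X ∩ A ∩ B) ∧
      #(X.filter fun x => f x = (true, false)) = #((X ∩ A) \ B)) ∧
      #(X.filter fun x => f x = (false, true)) = #((X \ A) ∩ B) ∧
      #(X.filter fun x => f x = (false, false)) = #((X \ A) \ B) := by
    refine ⟨⟨?_, ?_⟩, ?_, ?_⟩ <;> congr 1 <;> ext x <;> simp [f, and_assoc]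
  have hX (X : Finset Ω) :
      #(X ∩ A ∩ B) + #((X ∩ A) \ B) + #((X \ A) ∩ B) + #((X \ A) \ B) = #X ∧
      #((X \ A) ∩ B) + #((X \ A) \ B) = #(X \ A) ∧
      #(X ∩ A ∩ B) + #((X \ A) ∩ B) + #(B \ X) = #B := by
    have h1 := card_inter_add_card_sdiff X A
    have h2 := card_inter_add_card_sdiff (X ∩ A) B
    have h3 := card_inter_add_card_sdiff (X \ A) B
    have h4 := card_inter_add_card_sdiff B X
    have h5 := card_inter_add_card_sdiff (B ∩ X) A
    have h6 : B ∩ X ∩ A = X ∩ A ∩ B := by ext; simp; tauto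
    have h7 : (B ∩ X) \ A = (X \ A) ∩ B := by ext; simp; tauto
    rw [h6, h7] at h5
    omega
  have hU := hX univ
  have hAc : #Aᶜ = #(univ \ A) := by rw [compl_eq_univ_sdiff]
  have hBA : #((univ \ A) ∩ B) = c := by
    rw [← hB]; congr 1; ext; simp [and_comm]
  have hA : #(univ ∩ A ∩ B) + #((univ ∩ A) \ B) = #A := by
    rw [card_inter_add_card_sdiff, univ_inter]
  have hcA : c ≤ #A := by rw [← hB, ← hAB]; exact card_le_card sdiff_subset
  have hBu : #(B \ univ) = 0 := by simp
  rw [card_eq_sum_card_fiberwise (f := fun X => #A - c - #(X ∩ A ∩ B))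
    (t := range (a + b - c + 1))]
  · refine sum_congr rfl fun σ hσ => ?_
    rw [mem_range] at hσ
    rw [filter_filter]
    rcases le_or_gt σ (#A - c) with h | h
    · let k : Bool × Bool → ℕ := fun i => if i.1 then (if i.2 then #A - c - σ else c - a + σ)
        else (if i.2 then c - b + σ else a + b - c - σ)
      have key := card_filter_forall_card_filter_eq f k
      simp only [Prod.forall, Bool.forall_bool, Fintype.prod_prod_type, Fintype.prod_bool, hf] at key
      simp only [k] at key
      have e1 : #(univ ∩ A ∩ B) = #A - c := by omega
      have e2 : #((univ ∩ A) \ B) = c := by omega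
      have e4 : #((univ \ A) \ B) = #Aᶜ - c := by omega
      simp only [e1, e2, hBA, e4, if_true, Bool.false_eq_true, if_false] at key
      rw [Nat.choose_symm h] at key
      rw [mul_assoc, ← key]
      congr 1
      ext X
      simp only [mem_filter, mem_univ, true_and]
      have := hX X
      have l1 : #(X ∩ A ∩ B) ≤ #(univ ∩ A ∩ B) := by gcongr; simp
      rw [e1] at l1
      clear key hf f k
      generalize #(X ∩ A ∩ B) = x₁ at *
      generalize #((X ∩ A) \ B) = x₂ at *
      generalize #((X \ A) ∩ B) = x₃ at *
      generalize #((X \ A) \ B) = x₄ at *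
      generalize #(X \ A) = y₁ at *
      generalize #(B \ X) = y₂ at *
      generalize #X = y₃ at *
      obtain ⟨t1, t2, t3⟩ := this
      clear hX hAc hU hB hBA hA hBu e1 e2 e4
      constructor
      · rintro ⟨⟨rfl, rfl, rfl⟩, rfl⟩
        omega
      · intro hk
        omega
    · rw [Nat.choose_eq_zero_of_lt h, zero_mul, zero_mul, zero_mul, card_eq_zero,
        filter_eq_empty_iff]
      intro X _
      omega
  · intro X hX'
    simp only [mem_coe, mem_filter, mem_univ, true_and, mem_range] at hX' ⊢
    have := hX X
    have l1 : #((X ∩ A) \ B) ≤ #((univ ∩ A) \ B) := by gcongr; simp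
    omega

theorem exists_perm_card_image_sdiff {Ω : Type*} [Fintype Ω] [DecidableEq Ω] {A : Finset Ω} {c : ℕ}
    (h : c ≤ #A) (h' : c ≤ #Aᶜ) : ∃ g : Equiv.Perm Ω, #(A.image g \ A) = c := by
  obtain ⟨S, hS, hSc⟩ := exists_subset_card_eq (show #A - c ≤ #A by omega)
  obtain ⟨T, hT, hTc⟩ := exists_subset_card_eq h'
  have hd : Disjoint S T := disjoint_compl_right.mono hS hT
  have hcard : #(S ∪ T) = #A := by rw [card_union_of_disjoint hd]; omega
  have hpos : 0 < #{g : Equiv.Perm Ω | A.image g = S ∪ T} := by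
    rw [card_filter_image_perm_eq hcard]; positivity
  obtain ⟨g, hg⟩ := card_pos.1 hpos
  refine ⟨g, ?_⟩
  rw [(mem_filter.1 hg).2, union_sdiff_distrib, sdiff_eq_empty_iff_subset.2 hS, empty_union,
    sdiff_eq_self_of_disjoint, hTc]
  exact disjoint_compl_left.mono_left hT

theorem muC_phiMat (n : Fin 2 → ℕ) (a : ℕ) :
    muC n (phiMat n a) = ((n 0).factorial * (n 1).factorial : ℚ) ^ 2 /
      (((n 0 - a).factorial : ℚ) * a.factorial ^ 2 * (n 1 - a).factorial) := by
  simp only [muC, phiMat, Fin.prod_univ_two]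
  simp
  ring

theorem structure_constant_summand {N₀ N₁ a b c σ : ℕ} (hab : a + b ≤ N₁) (hac : a ≤ c)
    (hbc : b ≤ c) (hc : c ≤ a + b) (hcN : c ≤ N₀) (hσ : σ ≤ a + b - c) :
    ((N₀ - c).choose σ * c.choose (c - a + σ) * c.choose (c - b + σ) *
        (N₁ - c).choose (a + b - c - σ) : ℚ) =
      c.factorial ^ 2 * (N₁ - c).factorial /
        (a.factorial * b.factorial * (c - a).factorial * (c - b).factorial *
          (a + b - c).factorial * (N₁ - a - b).factorial) *
      ((poch (-(a : ℚ)) σ * poch (-(b : ℚ)) σ * poch ((c : ℚ) - a - b) σ *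
          poch ((c : ℚ) - (N₀ : ℚ)) σ) /
        (poch ((c : ℚ) - b + 1) σ * poch ((c : ℚ) - a + 1) σ *
          poch ((N₁ : ℚ) - a - b + 1) σ * (σ.factorial : ℚ))) := by
  obtain ⟨u, rfl⟩ := Nat.exists_eq_add_of_le hac
  obtain ⟨v, rfl⟩ : ∃ v, b = u + v := ⟨b - u, by omega⟩
  obtain ⟨w, rfl⟩ := Nat.exists_eq_add_of_le hbc |>.imp fun w (h : a + u = u + v + w) =>
    (show a = v + w by omega)
  obtain ⟨d, rfl⟩ : ∃ d, v = σ + d := ⟨v - σ, by omega⟩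
  obtain ⟨q, rfl⟩ := Nat.exists_eq_add_of_le hab
  obtain ⟨r, rfl⟩ := Nat.exists_eq_add_of_le hcN
  have e1 : ((σ + d + w + u : ℕ) : ℚ) - (σ + d + w : ℕ) - (u + (σ + d) : ℕ) =
      -((σ + d : ℕ) : ℚ) := by push_cast; ring
  have e2 : ((σ + d + w + u : ℕ) : ℚ) - (σ + d + w + u + r : ℕ) = -(r : ℚ) := by
    push_cast; ring
  have e3 : ((σ + d + w + u : ℕ) : ℚ) - (u + (σ + d) : ℕ) + 1 = (w : ℚ) + 1 := by
    push_cast; ring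
  have e4 : ((σ + d + w + u : ℕ) : ℚ) - (σ + d + w : ℕ) + 1 = (u : ℚ) + 1 := by
    push_cast; ring
  have e5 : ((σ + d + w + (u + (σ + d)) + q : ℕ) : ℚ) - (σ + d + w : ℕ) - (u + (σ + d) : ℕ) + 1 =
      (q : ℚ) + 1 := by push_cast; ring
  have f1 : σ + d + w + u + r - (σ + d + w + u) = r := by omega
  have f2 : σ + d + w + u - (σ + d + w) = u := by omega
  have f3 : σ + d + w + u - (u + (σ + d)) = w := by omega
  have f4 : σ + d + w + (u + (σ + d)) + q - (σ + d + w + u) = σ + d + q := by omega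
  have f5 : σ + d + w + (u + (σ + d)) - (σ + d + w + u) = σ + d := by omega
  have f6 : σ + d + w + (u + (σ + d)) + q - (σ + d + w) - (u + (σ + d)) = q := by omega
  rw [e1, e2, e3, e4, e5, f1, f2, f3, f4, f5, f6]
  rcases lt_or_ge r σ with h | h
  · simp [Nat.choose_eq_zero_of_lt h, poch_neg_natCast_of_lt h]
  obtain ⟨p, rfl⟩ := Nat.exists_eq_add_of_le h
  have g1 : σ + d + w - σ = d + w := by omega
  have g2 : u + (σ + d) - σ = u + d := by omega
  have g3 : σ + d - σ = d := by omega
  have g4 : σ + p - σ = p := by omega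
  have g5 : σ + d + w + u - (u + σ) = d + w := by omega
  have g6 : σ + d + w + u - (w + σ) = u + d := by omega
  have g7 : σ + d + q - d = q + σ := by omega
  rw [poch_neg_natCast (by omega), poch_neg_natCast (by omega), poch_neg_natCast (by omega),
    poch_neg_natCast h, poch_natCast_add_one, poch_natCast_add_one, poch_natCast_add_one,
    Nat.cast_choose ℚ h, Nat.cast_choose ℚ (by omega), Nat.cast_choose ℚ (by omega), g3,
    Nat.cast_choose ℚ (by omega), g1, g2, g4, g5, g6, g7]
  have hs : ((-1 : ℚ) ^ σ) ^ 4 = 1 := by rw [← pow_mul, mul_comm, pow_mul]; norm_num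
  field_simp
  rw [hs]

theorem stmt6 (n : Fin 2 → ℕ) (hn : ∀ j, 1 ≤ n j)
    (Ω : Type) [Fintype Ω] [DecidableEq Ω] (P : Fin 2 → Finset Ω)
    (hP : IsPartition n P)
    (a b c : ℕ) (ha : a ≤ min (n 0) (n 1)) (hb : b ≤ min (n 0) (n 1))
    (hab : a + b ≤ n 1) (hc₁ : max a b ≤ c) (hc₂ : c ≤ a + b)
    (hc₃ : c ≤ min (n 0) (n 1))
    (s : ℕ → ℚ)
    (hs : XiElt n P (phiMat n a) * XiElt n P (phiMat n b) =
      ∑ c' ∈ Finset.range (min (n 0) (n 1) + 1), s c' • XiElt n P (phiMat n c')) :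
    s c =
      ((a.factorial : ℚ) * (b.factorial : ℚ) * ((n 0 - a).factorial : ℚ) *
          ((n 1 - a).factorial : ℚ) * ((n 0 - b).factorial : ℚ) * ((n 1 - b).factorial : ℚ)) /
        (((n 0).factorial : ℚ) * ((n 1).factorial : ℚ) * ((n 0 - c).factorial : ℚ) *
          ((n 1 - a - b).factorial : ℚ) * ((a + b - c).factorial : ℚ) *
          ((c - a).factorial : ℚ) * ((c - b).factorial : ℚ)) *
      ∑ σ ∈ Finset.range (a + b - c + 1),
        (poch (-(a : ℚ)) σ * poch (-(b : ℚ)) σ * poch ((c : ℚ) - a - b) σ *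
            poch ((c : ℚ) - (n 0 : ℚ)) σ) /
          (poch ((c : ℚ) - b + 1) σ * poch ((c : ℚ) - a + 1) σ *
            poch ((n 1 : ℚ) - a - b + 1) σ * (σ.factorial : ℚ)) := by
  obtain ⟨hac, hbc⟩ := max_le_iff.1 hc₁
  obtain ⟨hc0, hc1⟩ := le_min_iff.1 hc₃
  have h0 := hP.2.2 0
  have h1 : #(P 0)ᶜ = n 1 := by rw [← eq_compl_of_isPartition hP, hP.2.2]
  obtain ⟨g, hg⟩ := exists_perm_card_image_sdiff (A := P 0) (c := c) (by omega) (by omega)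
  have hcoeff := congrArg (fun x => x.coeff g) hs
  simp only [coeff_XiElt_mul_XiElt, MonoidAlgebra.coeff_sum, Finsupp.finsetSum_apply,
    MonoidAlgebra.coeff_smul_apply, coeff_XiElt, mem_xiFinset_phiMat hP, hg, smul_eq_mul,
    mul_ite, mul_zero] at hcoeff
  rw [sum_ite_eq, if_pos (mem_range.2 (by omega))] at hcoeff
  have himage (h : Equiv.Perm Ω) :
      #((P 0).image (h⁻¹ * g) \ P 0) = #((P 0).image g \ (P 0).image h) := by
    rw [← card_image_of_injective _ h.injective, image_sdiff _ _ h.injective, image_image,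
      ← Equiv.Perm.coe_mul, mul_inv_cancel_left]
  simp only [himage] at hcoeff
  rw [card_filter_image_perm (P 0) fun X => #(X \ P 0) = a ∧ #((P 0).image g \ X) = b,
    card_filter_card_sdiff (card_image_of_injective _ g.injective) hg hac hbc hc₂, h0, h1]
    at hcoeff
  push_cast at hcoeff
  rw [sum_congr rfl fun σ hσ => structure_constant_summand hab hac hbc hc₂ hc0
    (Nat.le_of_lt_succ (mem_range.1 hσ)), ← mul_sum] at hcoeff
  rw [muC_phiMat, muC_phiMat, muC_phiMat, eq_comm,
    mul_inv_eq_iff_eq_mul₀ (by positivity)] at hcoeff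
  rw [hcoeff, Nat.succ_eq_add_one]
  field_simp
end

section
/- Let i ≠ j and let x, x' ∈ P_i and y, y' ∈ P_j. Then in ℚ[Sym(Ω)] one has Π·(x y)·Π = Π·(x' y')·Π, where (x y) denotes the transposition of x and y, and this common element equals Ξ of the matrix Σ_{k ≠ i,j} n_k E_kk + (n_i − 1)E_ii + (n_j − 1)E_jj + E_ij + E_ji (here E_pq is the ν×ν matrix with a 1 in position (p,q) and zeros elsewhere). -/
open Finset

def youngFinset {Ω : Type} [Fintype Ω] [DecidableEq Ω] {ν : ℕ} (P : Fin ν → Finset Ω) :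
    Finset (Equiv.Perm Ω) :=
  Finset.univ.filter (fun g => ∀ j, (P j).image ⇑g = P j)

noncomputable def PiElt {Ω : Type} [Fintype Ω] [DecidableEq Ω] {ν : ℕ}
    (n : Fin ν → ℕ) (P : Fin ν → Finset Ω) : MonoidAlgebra ℚ (Equiv.Perm Ω) :=
  (∏ j, ((n j).factorial : ℚ))⁻¹ •
    ∑ h ∈ youngFinset P, MonoidAlgebra.of ℚ (Equiv.Perm Ω) h

/-- The matrix `Σ_{k ≠ i,j} n_k E_kk + (n_i−1)E_ii + (n_j−1)E_jj + E_ij + E_ji`. -/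
def rMat {ν : ℕ} (n : Fin ν → ℕ) (i j : Fin ν) : Fin ν → Fin ν → ℕ :=
  fun p q =>
    if p = q then (if p = i ∨ p = j then n p - 1 else n p)
    else if (p = i ∧ q = j) ∨ (p = j ∧ q = i) then 1 else 0

theorem exists_partition_class {Ω : Type} [Fintype Ω] {ν : ℕ} {n : Fin ν → ℕ}
    {P : Fin ν → Finset Ω} (hP : IsPartition n P) :
    ∃ c : Ω → Fin ν, ∀ ω j, ω ∈ P j ↔ c ω = j := by
  obtain ⟨hdisj, hcover, -⟩ := hP
  choose c hc using hcover
  refine ⟨c, fun ω j => ⟨fun h => ?_, fun h => h ▸ hc ω⟩⟩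
  by_contra hne
  exact Finset.disjoint_left.mp (hdisj _ _ hne) (hc ω) h

section

variable {Ω : Type} [Fintype Ω] [DecidableEq Ω] {ν : ℕ} {n : Fin ν → ℕ}
  {P : Fin ν → Finset Ω} {c : Ω → Fin ν}

theorem mem_youngFinset_iff (hc : ∀ ω j, ω ∈ P j ↔ c ω = j) (h : Equiv.Perm Ω) :
    h ∈ youngFinset P ↔ ∀ ω, c (h ω) = c ω := by
  simp only [youngFinset, Finset.mem_filter, Finset.mem_univ, true_and]
  constructor
  · intro H ω
    rw [← hc, ← H]
    exact Finset.mem_image_of_mem _ ((hc _ _).mpr rfl)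
  · intro H j
    refine Finset.eq_of_subset_of_card_le (fun z hz => ?_)
      (Finset.card_image_of_injective _ h.injective).ge
    obtain ⟨ω, hω, rfl⟩ := Finset.mem_image.mp hz
    rw [hc] at hω ⊢
    rw [H, hω]

theorem countMat_eq_card_fiber (hc : ∀ ω j, ω ∈ P j ↔ c ω = j) (g : Equiv.Perm Ω)
    (p q : Fin ν) :
    countMat P g p q = Fintype.card {ω // (c ω, c (g ω)) = (p, q)} := by
  rw [Fintype.card_subtype, countMat,
    ← Finset.card_image_of_injective (Finset.univ.filter fun ω => (c ω, c (g ω)) = (p, q))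
      g.injective]
  congr 1
  ext z
  simp only [Finset.mem_inter, Finset.mem_image, Finset.mem_filter, Finset.mem_univ, true_and,
    Prod.mk.injEq, hc]
  constructor
  · rintro ⟨⟨ω, h, rfl⟩, h'⟩
    exact ⟨ω, ⟨h, h'⟩, rfl⟩
  · rintro ⟨ω, ⟨h, h'⟩, rfl⟩
    exact ⟨⟨ω, h, rfl⟩, h'⟩

theorem countMat_mul_mul (hc : ∀ ω j, ω ∈ P j ↔ c ω = j) {h k : Equiv.Perm Ω}
    (hh : h ∈ youngFinset P) (hk : k ∈ youngFinset P) (g : Equiv.Perm Ω) (p q : Fin ν) :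
    countMat P (h * g * k) p q = countMat P g p q := by
  rw [mem_youngFinset_iff hc] at hh hk
  rw [countMat_eq_card_fiber hc, countMat_eq_card_fiber hc]
  refine Fintype.card_congr (k.subtypeEquiv fun ω => ?_)
  simp [hh, hk]

theorem exists_perm_comp_eq_of_card_fiber_eq {α γ : Type*} [Fintype α] [DecidableEq γ]
    {f f' : α → γ} (h : ∀ d, Fintype.card {a // f' a = d} = Fintype.card {a // f a = d}) :
    ∃ k : Equiv.Perm α, ∀ a, f (k a) = f' a :=
  ⟨Equiv.ofFiberEquiv fun d => Fintype.equivOfCardEq (h d), Equiv.ofFiberEquiv_map _⟩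

theorem card_perm_comp_eq {α γ : Type*} [Fintype α] [DecidableEq α] [Fintype γ] [DecidableEq γ]
    {f f' : α → γ} (h : ∀ d, Fintype.card {a // f' a = d} = Fintype.card {a // f a = d}) :
    #{k : Equiv.Perm α | ∀ a, f (k a) = f' a} = ∏ d, (Fintype.card {a // f a = d}).factorial := by
  obtain ⟨k₀, hk₀⟩ := exists_perm_comp_eq_of_card_fiber_eq h
  rw [← DomMulAct.stabilizer_card f, Fintype.card_subtype]
  refine Finset.card_equiv (Equiv.mulRight k₀⁻¹) fun k => ?_
  simp only [Finset.mem_filter, Finset.mem_univ, true_and, Equiv.coe_mulRight, funext_iff,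
    Function.comp_apply, Equiv.Perm.coe_mul]
  constructor
  · intro H a
    simp [H, ← hk₀]
  · intro H a
    simp [← hk₀, ← H (k₀ a)]

theorem card_doubleCoset_fiber (hc : ∀ ω j, ω ∈ P j ↔ c ω = j) (g : Equiv.Perm Ω)
    {g' : Equiv.Perm Ω} (hg' : g' ∈ xiFinset P (countMat P g)) :
    #{hk ∈ youngFinset P ×ˢ youngFinset P | hk.1 * g * hk.2 = g'} =
      ∏ p, ∏ q, (countMat P g p q).factorial := by
  have hcard : ∀ d : Fin ν × Fin ν, Fintype.card {ω // (c ω, c (g' ω)) = d} =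
      Fintype.card {ω // (c ω, c (g ω)) = d} := by
    rintro ⟨p, q⟩
    rw [← countMat_eq_card_fiber hc, ← countMat_eq_card_fiber hc]
    exact (Finset.mem_filter.mp hg').2 p q
  simp_rw [countMat_eq_card_fiber hc]
  rw [← Fintype.prod_prod_type'
    (f := fun p q => (Fintype.card {ω // (c ω, c (g ω)) = (p, q)}).factorial),
    ← card_perm_comp_eq hcard]
  refine Finset.card_nbij' Prod.snd (fun k => (g' * k⁻¹ * g⁻¹, k)) ?_ ?_ ?_ ?_
  · rintro ⟨h, k⟩ hm
    simp only [Finset.coe_filter, Finset.mem_product, mem_youngFinset_iff hc,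
      Set.mem_ofPred_eq, Finset.mem_univ, true_and, Prod.mk.injEq] at hm ⊢
    obtain ⟨⟨hh, hk⟩, rfl⟩ := hm
    exact fun ω => ⟨hk ω, (hh _).symm⟩
  · intro k hm
    simp only [Finset.coe_filter, Finset.mem_product, mem_youngFinset_iff hc,
      Set.mem_ofPred_eq, Finset.mem_univ, true_and, Prod.mk.injEq] at hm ⊢
    refine ⟨⟨fun ω => ?_, fun ω => (hm ω).1⟩, by group⟩
    simpa using (hm (k⁻¹ (g⁻¹ ω))).2.symm
  · rintro ⟨h, k⟩ hm
    obtain ⟨-, rfl⟩ := Finset.mem_filter.mp hm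
    simp [mul_assoc]
  · intro k _
    rfl

theorem PiElt_mul_of_mul_PiElt (hP : IsPartition n P) (g : Equiv.Perm Ω) :
    PiElt n P * MonoidAlgebra.of ℚ (Equiv.Perm Ω) g * PiElt n P =
      XiElt n P (countMat P g) := by
  obtain ⟨c, hc⟩ := exists_partition_class hP
  have hmaps : ∀ hk ∈ youngFinset P ×ˢ youngFinset P,
      hk.1 * g * hk.2 ∈ xiFinset P (countMat P g) := fun hk hm =>
    Finset.mem_filter.mpr ⟨Finset.mem_univ _, countMat_mul_mul hc
      (Finset.mem_product.mp hm).1 (Finset.mem_product.mp hm).2 g⟩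
  have hsum : (∑ h ∈ youngFinset P, MonoidAlgebra.of ℚ (Equiv.Perm Ω) h) *
      MonoidAlgebra.of ℚ (Equiv.Perm Ω) g *
      ∑ k ∈ youngFinset P, MonoidAlgebra.of ℚ (Equiv.Perm Ω) k =
      ((∏ p, ∏ q, (countMat P g p q).factorial : ℕ) : ℚ) •
        ∑ g' ∈ xiFinset P (countMat P g), MonoidAlgebra.of ℚ (Equiv.Perm Ω) g' := by
    rw [Finset.sum_mul, Finset.sum_mul_sum, ← Finset.sum_product', Finset.smul_sum,
      ← Finset.sum_fiberwise_of_maps_to hmaps]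
    refine Finset.sum_congr rfl fun g' hg' => ?_
    rw [← card_doubleCoset_fiber hc g hg', Nat.cast_smul_eq_nsmul, ← Finset.sum_const]
    refine Finset.sum_congr rfl fun hk hm => ?_
    rw [← map_mul, ← map_mul, (Finset.mem_filter.mp hm).2]
  rw [PiElt, XiElt, smul_mul_assoc, smul_mul_assoc, mul_smul_comm, hsum, smul_smul, smul_smul]
  congr 1
  rw [muC, inv_div]
  push_cast
  rw [div_eq_mul_inv, ← inv_pow]
  ring

theorem countMat_swap (hP : IsPartition n P) {i j : Fin ν} (hij : i ≠ j) {x y : Ω}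
    (hx : x ∈ P i) (hy : y ∈ P j) : countMat P (Equiv.swap x y) = rMat n i j := by
  obtain ⟨c, hc⟩ := exists_partition_class hP
  have hcx := (hc _ _).mp hx
  have hcy := (hc _ _).mp hy
  have himage : ∀ p q, (P p).image (Equiv.swap x y) ∩ P q =
      if p = q then (if p = i then (P p).erase x else if p = j then (P p).erase y else P p)
      else if p = i ∧ q = j then {y} else if p = j ∧ q = i then {x} else ∅ := by
    intro p q
    ext z
    have hz : z ∈ (P p).image (Equiv.swap x y) ↔ c (Equiv.swap x y z) = p := by
      rw [← hc, Finset.mem_image]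
      constructor
      · rintro ⟨w, hw, rfl⟩
        simpa using hw
      · exact fun h => ⟨_, h, by simp⟩
    rw [Finset.mem_inter, hz, Equiv.swap_apply_def]
    grind
  funext p q
  have hcard := hP.2.2
  rw [countMat, himage, rMat]
  grind

end

theorem stmt7 (ν : ℕ) (hν : 2 ≤ ν) (n : Fin ν → ℕ) (hn : ∀ j, 1 ≤ n j)
    (Ω : Type) [Fintype Ω] [DecidableEq Ω] (P : Fin ν → Finset Ω)
    (hP : IsPartition n P)
    (i j : Fin ν) (hij : i ≠ j)
    (x x' y y' : Ω) (hx : x ∈ P i) (hx' : x' ∈ P i) (hy : y ∈ P j) (hy' : y' ∈ P j) :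
    PiElt n P * MonoidAlgebra.of ℚ (Equiv.Perm Ω) (Equiv.swap x y) * PiElt n P =
      PiElt n P * MonoidAlgebra.of ℚ (Equiv.Perm Ω) (Equiv.swap x' y') * PiElt n P ∧
    PiElt n P * MonoidAlgebra.of ℚ (Equiv.Perm Ω) (Equiv.swap x y) * PiElt n P =
      XiElt n P (rMat n i j) := by
  rw [PiElt_mul_of_mul_PiElt hP, PiElt_mul_of_mul_PiElt hP, countMat_swap hP hij hx hy,
    countMat_swap hP hij hx' hy']
  exact ⟨rfl, rfl⟩
end
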